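/- Let V and X be separable complex Hilbert spaces, let J : V → X be a bounded linear operator, and let (e_i)_{i∈ℕ} be a Hilbert basis of V with Σ_i ‖J e_i‖² < ∞ (i.e. J is Hilbert–Schmidt with squared Hilbert–Schmidt norm Σ_i ‖J e_i‖²). Let (Ω_P, 𝒜, P) be a probability space and let Z : X → L²(Ω_P, P) be a linear map such that there is a constant C ≥ 0 with E|Z(v)|² ≤ C‖v‖²_X for all v ∈ X. Then for every countable set B contained in the closed unit ball of V, E[ sup_{v∈B} |Z(J v)|² ] ≤ C · Σ_i ‖J e_i‖². -/

import Mathlib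

open MeasureTheory
open scoped ENNReal

/-- A random variable in `L²` whose second moment is at most `C * r ^ 2` has `L²` norm at most
`√C * r`. -/
theorem Lp_two_norm_le_of_lintegral_sq_le {Ω : Type*} [MeasurableSpace Ω] {μ : Measure Ω}
    (f : Lp ℂ 2 μ) {C r : ℝ} (hC : 0 ≤ C) (hr : 0 ≤ r)
    (h : (∫⁻ ω, ((‖f ω‖₊ : ℝ≥0∞) ^ 2) ∂μ) ≤ ENNReal.ofReal (C * r ^ 2)) :
    ‖f‖ ≤ √C * r := by
  have h1 : eLpNorm f 2 μ ^ 2 = ∫⁻ ω, ((‖f ω‖₊ : ℝ≥0∞) ^ 2) ∂μ := by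
    have := eLpNorm_nnreal_pow_eq_lintegral (f := f) (μ := μ) (p := 2) two_ne_zero
    simpa [enorm_eq_nnnorm] using this
  have h2 : ENNReal.ofReal (C * r ^ 2) = ENNReal.ofReal (√C * r) ^ 2 := by
    rw [← ENNReal.ofReal_pow (by positivity), mul_pow, Real.sq_sqrt hC]
  rw [← h1, h2] at h
  rw [Lp.norm_def]
  exact ENNReal.toReal_le_of_le_ofReal (by positivity)
    ((ENNReal.pow_le_pow_left_iff two_ne_zero).1 h)

/-- Cauchy–Schwarz against a square-summable coefficient vector, in extended nonnegative reals. -/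
theorem nnnorm_sum_smul_sq_le_tsum (s : Finset ℕ) (c a : ℕ → ℂ)
    (hc : ∑ i ∈ s, ‖c i‖ ^ 2 ≤ 1) :
    (‖∑ i ∈ s, c i • a i‖₊ : ℝ≥0∞) ^ 2 ≤ ∑' i, (‖a i‖₊ : ℝ≥0∞) ^ 2 := by
  have h : ‖∑ i ∈ s, c i • a i‖ ^ 2 ≤ ∑ i ∈ s, ‖a i‖ ^ 2 := calc
    _ ≤ (∑ i ∈ s, ‖c i‖ * ‖a i‖) ^ 2 := by
      gcongr
      exact norm_sum_le_of_le s fun i _ => (norm_smul _ _).le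
    _ ≤ (∑ i ∈ s, ‖c i‖ ^ 2) * ∑ i ∈ s, ‖a i‖ ^ 2 := Finset.sum_mul_sq_le_sq_mul_sq _ _ _
    _ ≤ _ := mul_le_of_le_one_left (by positivity) hc
  have h' : ‖∑ i ∈ s, c i • a i‖₊ ^ 2 ≤ ∑ i ∈ s, ‖a i‖₊ ^ 2 := by
    rw [← NNReal.coe_le_coe]
    push_cast
    exact h
  exact le_trans (by exact_mod_cast h') (ENNReal.sum_le_tsum s)

/-- A continuous linear map into `L²` is, at each vector of the unit ball, almost surely dominated
by its square function along a Hilbert basis. -/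
theorem ae_nnnorm_sq_le_tsum {V : Type*} [NormedAddCommGroup V] [InnerProductSpace ℂ V]
    (e : HilbertBasis ℕ ℂ V) {Ω : Type*} [MeasurableSpace Ω] {μ : Measure Ω}
    (T : V →L[ℂ] Lp ℂ 2 μ) {v : V} (hv : ‖v‖ ≤ 1) :
    ∀ᵐ ω ∂μ, (‖T v ω‖₊ : ℝ≥0∞) ^ 2 ≤ ∑' i, (‖T (e i) ω‖₊ : ℝ≥0∞) ^ 2 := by
  let u : ℕ → V := fun n => ∑ i ∈ Finset.range n, e.repr v i • e i
  have hu : Filter.Tendsto (fun n => T (u n)) Filter.atTop (nhds (T v)) :=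
    (T.continuous.tendsto v).comp (e.hasSum_repr v).tendsto_sum_nat
  obtain ⟨ns, -, hns⟩ := (tendstoInMeasure_of_tendsto_Lp hu).exists_seq_tendsto_ae
  have hae : ∀ᵐ ω ∂μ, ∀ n,
      T (u n) ω = ∑ i ∈ Finset.range n, e.repr v i • T (e i) ω := by
    rw [ae_all_iff]
    intro n
    have hTu : T (u n) = ∑ i ∈ Finset.range n, e.repr v i • T (e i) := by simp [u]
    rw [hTu]
    have hsmul : ∀ᵐ ω ∂μ, ∀ i, (e.repr v i • T (e i) : Lp ℂ 2 μ) ω = e.repr v i • T (e i) ω :=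
      ae_all_iff.2 fun i => Lp.coeFn_smul _ _
    filter_upwards [Lp.coeFn_finsetSum (Finset.range n) fun i => e.repr v i • T (e i), hsmul]
      with ω h1 h2
    rw [h1, Finset.sum_apply]
    exact Finset.sum_congr rfl fun i _ => h2 i
  have hc : ∀ n, ∑ i ∈ Finset.range n, ‖e.repr v i‖ ^ 2 ≤ 1 := fun n => by
    simp_rw [e.repr_apply_apply]
    exact (e.orthonormal.sum_inner_products_le v).trans (pow_le_one₀ (norm_nonneg v) hv)
  filter_upwards [hns, hae] with ω h1 h2
  have hlim : Filter.Tendsto (fun n => (‖T (u (ns n)) ω‖₊ : ℝ≥0∞) ^ 2) Filter.atTop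
      (nhds ((‖T v ω‖₊ : ℝ≥0∞) ^ 2)) :=
    ENNReal.Tendsto.pow (ENNReal.tendsto_coe.2 h1.nnnorm)
  refine le_of_tendsto' hlim fun n => ?_
  rw [h2]
  exact nnnorm_sum_smul_sq_le_tsum _ _ _ (hc _)

/-- If `J : V → X` is Hilbert–Schmidt (with respect to a Hilbert basis `(e_i)` of `V`)
and `Z` is a Hilbert space process on `X` with second moments bounded by `C`, then
`E[sup_{v ∈ B} |Z(Jv)|²] ≤ C · Σ_i ‖J e_i‖²` for every countable subset `B` of the
closed unit ball of `V`. -/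
theorem stmt_10 {V X : Type*}
    [NormedAddCommGroup V] [InnerProductSpace ℂ V] [CompleteSpace V]
    [NormedAddCommGroup X] [InnerProductSpace ℂ X] [CompleteSpace X]
    (J : V →L[ℂ] X) (e : HilbertBasis ℕ ℂ V)
    (hHS : Summable fun i : ℕ => ‖J (e i)‖ ^ 2)
    {Ω_P : Type*} [MeasurableSpace Ω_P] (P : Measure Ω_P) [IsProbabilityMeasure P]
    (Z : X →ₗ[ℂ] Lp ℂ 2 P) (C : ℝ) (hC : 0 ≤ C)
    (hZ : ∀ v : X, (∫⁻ ω, ((‖(Z v : Lp ℂ 2 P) ω‖₊ : ℝ≥0∞) ^ 2) ∂P)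
      ≤ ENNReal.ofReal (C * ‖v‖ ^ 2))
    (B : Set V) (hB_count : B.Countable) (hB : B ⊆ Metric.closedBall 0 1) :
    (∫⁻ ω, ⨆ v ∈ B, ((‖(Z (J v) : Lp ℂ 2 P) ω‖₊ : ℝ≥0∞) ^ 2) ∂P)
      ≤ ENNReal.ofReal (C * ∑' i : ℕ, ‖J (e i)‖ ^ 2) := by
  obtain ⟨T, hT⟩ : ∃ T : V →L[ℂ] Lp ℂ 2 P, ∀ v, T v = Z (J v) :=
    ⟨(Z.mkContinuous (√C) fun x =>
      Lp_two_norm_le_of_lintegral_sq_le (Z x) hC (norm_nonneg x) (hZ x)).comp J, fun _ => rfl⟩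
  have hae : ∀ᵐ ω ∂P, ∀ v ∈ B, (‖(Z (J v) : Lp ℂ 2 P) ω‖₊ : ℝ≥0∞) ^ 2
      ≤ ∑' i, (‖(Z (J (e i)) : Lp ℂ 2 P) ω‖₊ : ℝ≥0∞) ^ 2 := by
    refine (ae_ball_iff hB_count).2 fun v hv => ?_
    simpa only [hT] using ae_nnnorm_sq_le_tsum e T (mem_closedBall_zero_iff.1 (hB hv))
  have hmeas : ∀ i, AEMeasurable (fun ω => (‖(Z (J (e i)) : Lp ℂ 2 P) ω‖₊ : ℝ≥0∞) ^ 2) P := by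
    intro i
    have h := (Lp.aestronglyMeasurable (Z (J (e i)))).enorm
    simp only [enorm_eq_nnnorm] at h
    exact h.pow_const 2
  calc
    _ ≤ ∫⁻ ω, ∑' i, (‖(Z (J (e i)) : Lp ℂ 2 P) ω‖₊ : ℝ≥0∞) ^ 2 ∂P :=
      lintegral_mono_ae (hae.mono fun ω h => iSup₂_le h)
    _ = ∑' i, ∫⁻ ω, (‖(Z (J (e i)) : Lp ℂ 2 P) ω‖₊ : ℝ≥0∞) ^ 2 ∂P :=
      lintegral_tsum hmeas
    _ ≤ ∑' i, ENNReal.ofReal (C * ‖J (e i)‖ ^ 2) := ENNReal.tsum_le_tsum fun i => hZ _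
    _ = ENNReal.ofReal (C * ∑' i, ‖J (e i)‖ ^ 2) := by
      rw [← tsum_mul_left, ENNReal.ofReal_tsum_of_nonneg (fun i => by positivity)
        (hHS.mul_left C)]
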